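/- arXiv:1907.04617 — 3 statements merged into one kernel-verified Lean document; each statement's English description precedes it below -/
import Mathlib

section
/- Let n > 1 and let L be the second order cone in ℝ^n. A matrix A ∈ ℝ^{n×n} is a Z-transformation on L if and only if there exist a real number γ, a symmetric matrix P that is copositive on L (i.e., xᵀPx ≥ 0 for all x ∈ L), and a skew-symmetric matrix Q such that A = γ·I − J(P + Q), where J = diag(1,−1,…,−1). -/
open Matrix

noncomputable section

/-- The second order cone in `ℝⁿ`: `{(t,u) : t ≥ ‖u‖}` (first coordinate is `t`). -/
def soc (n : ℕ) [NeZero n] : Set (Fin n → ℝ) :=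
  {x | Real.sqrt (∑ i, if i = 0 then 0 else (x i) ^ 2) ≤ x 0}

/-- The boundary of the second order cone: `{(t,u) : t = ‖u‖}`. -/
def socBd (n : ℕ) [NeZero n] : Set (Fin n → ℝ) :=
  {x | Real.sqrt (∑ i, if i = 0 then 0 else (x i) ^ 2) = x 0}

/-- `J = diag(1, -1, …, -1)`. -/
def Jmat (n : ℕ) [NeZero n] : Matrix (Fin n) (Fin n) ℝ :=
  Matrix.diagonal (fun i => if i = 0 then 1 else -1)

/-- The dual cone of a set `K ⊆ ℝⁿ`. -/
def dualCone {n : ℕ} (K : Set (Fin n → ℝ)) : Set (Fin n → ℝ) :=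
  {y | ∀ x ∈ K, 0 ≤ x ⬝ᵥ y}

/-- `A` is a Z-transformation on `K`: `x ∈ K`, `y ∈ K*`, `⟨x,y⟩ = 0` imply `⟨Ax,y⟩ ≤ 0`. -/
def IsZTransf {n : ℕ} (K : Set (Fin n → ℝ)) (A : Matrix (Fin n) (Fin n) ℝ) : Prop :=
  ∀ x ∈ K, ∀ y ∈ dualCone K, x ⬝ᵥ y = 0 → (A.mulVec x) ⬝ᵥ y ≤ 0

/-- The completely positive cone of `C`: all finite sums `∑ uᵢuᵢᵀ` with `uᵢ ∈ C`. -/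
def cpCone {n : ℕ} (C : Set (Fin n → ℝ)) : Set (Matrix (Fin n) (Fin n) ℝ) :=
  {X | ∃ (m : ℕ) (u : Fin m → Fin n → ℝ), (∀ i, u i ∈ C) ∧ X = ∑ i, vecMulVec (u i) (u i)}

/-- The copositive cone of `C`: symmetric matrices `A` with `xᵀAx ≥ 0` for all `x ∈ C`. -/
def copCone {n : ℕ} (C : Set (Fin n → ℝ)) : Set (Matrix (Fin n) (Fin n) ℝ) :=
  {A | Aᵀ = A ∧ ∀ x ∈ C, 0 ≤ x ⬝ᵥ A.mulVec x}

/-- `Ω = {(x,y) ∈ L × L : ‖x‖ = 1 = ‖y‖, ⟨x,y⟩ = 0}`. -/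
def OmegaSet (n : ℕ) [NeZero n] : Set ((Fin n → ℝ) × (Fin n → ℝ)) :=
  {p | p.1 ∈ soc n ∧ p.2 ∈ soc n ∧ Real.sqrt (∑ i, p.1 i ^ 2) = 1 ∧
       Real.sqrt (∑ i, p.2 i ^ 2) = 1 ∧ p.1 ⬝ᵥ p.2 = 0}

/-- `γ(A) = max {⟨Ax,y⟩ : (x,y) ∈ Ω}`. -/
def gammaFun (n : ℕ) [NeZero n] (A : Matrix (Fin n) (Fin n) ℝ) : ℝ :=
  sSup {r | ∃ p ∈ OmegaSet n, r = (A.mulVec p.1) ⬝ᵥ p.2}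

section SecondOrderCone

variable {n : ℕ}

theorem dotProduct_self_nonneg_real (x : Fin n → ℝ) : 0 ≤ x ⬝ᵥ x :=
  Finset.sum_nonneg fun i _ => mul_self_nonneg (x i)

theorem sum_spatial_sq [NeZero n] (x : Fin n → ℝ) :
    (∑ i, if i = 0 then 0 else (x i) ^ 2) = x ⬝ᵥ x - x 0 ^ 2 := by
  have h : x ⬝ᵥ x = (∑ i, if i = 0 then 0 else (x i) ^ 2) + ∑ i, if i = 0 then (x i) ^ 2 else 0 := by
    rw [dotProduct, ← Finset.sum_add_distrib]
    refine Finset.sum_congr rfl fun i _ => ?_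
    split_ifs <;> ring
  rw [h]
  simp

theorem mem_soc_iff [NeZero n] {x : Fin n → ℝ} :
    x ∈ soc n ↔ 0 ≤ x 0 ∧ x ⬝ᵥ x ≤ 2 * x 0 ^ 2 := by
  simp only [soc, Set.mem_ofPred_eq, sum_spatial_sq, Real.sqrt_le_iff]
  exact and_congr_right fun _ => ⟨fun h => by linarith, fun h => by linarith⟩

theorem Jmat_mul_self [NeZero n] : Jmat n * Jmat n = 1 := by
  rw [Jmat, diagonal_mul_diagonal, ← diagonal_one]
  congr 1
  funext i
  split_ifs <;> norm_num

theorem Jmat_transpose [NeZero n] : (Jmat n)ᵀ = Jmat n := diagonal_transpose _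

theorem Jmat_mulVec [NeZero n] (x : Fin n → ℝ) :
    Jmat n *ᵥ x = (2 * x 0) • Pi.single 0 1 - x := by
  funext i
  rw [Jmat, mulVec_diagonal]
  by_cases h : i = 0
  · subst h
    simp
    ring
  · simp [h]

theorem dotProduct_Jmat_mulVec [NeZero n] (x y : Fin n → ℝ) :
    x ⬝ᵥ (Jmat n *ᵥ y) = 2 * (x 0 * y 0) - x ⬝ᵥ y := by
  rw [Jmat_mulVec]
  simp
  ring

theorem Jmat_mulVec_mem_soc [NeZero n] {x : Fin n → ℝ} (hx : x ∈ soc n) :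
    Jmat n *ᵥ x ∈ soc n := by
  rw [mem_soc_iff] at hx ⊢
  have h0 : (Jmat n *ᵥ x) 0 = x 0 := by simp [Jmat, mulVec_diagonal]
  rw [dotProduct_Jmat_mulVec, dotProduct_comm, dotProduct_Jmat_mulVec, h0]
  exact ⟨hx.1, by linarith [hx.2]⟩

theorem dotProduct_self_smul_sub_smul_Jmat_le [NeZero n] {x y : Fin n → ℝ}
    (hx : x ∈ soc n) (hy : y ∈ soc n) :
    (y 0 • x - x 0 • (Jmat n *ᵥ y)) ⬝ᵥ (y 0 • x - x 0 • (Jmat n *ᵥ y)) ≤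
      2 * (x 0 * y 0) * (x ⬝ᵥ y) := by
  rw [mem_soc_iff] at hx hy
  have h0 : (Jmat n *ᵥ y) 0 = y 0 := by simp [Jmat, mulVec_diagonal]
  have hJ : (Jmat n *ᵥ y) ⬝ᵥ (Jmat n *ᵥ y) = y ⬝ᵥ y := by
    rw [dotProduct_Jmat_mulVec, dotProduct_comm, dotProduct_Jmat_mulVec, h0]
    ring
  simp only [sub_dotProduct, dotProduct_sub, smul_dotProduct, dotProduct_smul, smul_eq_mul, hJ,
    dotProduct_comm (Jmat n *ᵥ y) x, dotProduct_Jmat_mulVec]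
  nlinarith [mul_le_mul_of_nonneg_left hx.2 (sq_nonneg (y 0)),
    mul_le_mul_of_nonneg_left hy.2 (sq_nonneg (x 0))]

theorem eq_zero_of_mem_soc [NeZero n] {x : Fin n → ℝ} (hx : x ∈ soc n) (h : x 0 = 0) : x = 0 := by
  have h2 := (mem_soc_iff.1 hx).2
  rw [h] at h2
  exact dotProduct_self_eq_zero.1
    (le_antisymm (by simpa using h2) (dotProduct_self_nonneg_real x))

theorem soc_subset_dualCone [NeZero n] : soc n ⊆ dualCone (soc n) := by
  intro y hy x hx
  have h := (dotProduct_self_nonneg_real _).trans (dotProduct_self_smul_sub_smul_Jmat_le hx hy)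
  rcases (mem_soc_iff.1 hx).1.eq_or_lt with hx0 | hx0
  · simp [eq_zero_of_mem_soc hx hx0.symm]
  rcases (mem_soc_iff.1 hy).1.eq_or_lt with hy0 | hy0
  · simp [eq_zero_of_mem_soc hy hy0.symm]
  exact nonneg_of_mul_nonneg_right h (by positivity)

theorem dualCone_subset_soc [NeZero n] : dualCone (soc n) ⊆ soc n := by
  intro y hy
  have hs : 0 ≤ y ⬝ᵥ y - y 0 ^ 2 := by
    rw [← sum_spatial_sq]
    exact Finset.sum_nonneg fun i _ => by split_ifs <;> positivity
  have h0 : 0 ≤ y 0 := by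
    simpa using hy (Pi.single 0 1) (mem_soc_iff.2 (by simp))
  set r := Real.sqrt (y ⬝ᵥ y - y 0 ^ 2) with hr
  have hr0 : 0 ≤ r := Real.sqrt_nonneg _
  have hr2 : r ^ 2 = y ⬝ᵥ y - y 0 ^ 2 := Real.sq_sqrt hs
  have h1 := hy ((r + y 0) • Pi.single 0 1 - y) (mem_soc_iff.2 (by
    simp [sub_dotProduct, dotProduct_sub]
    refine ⟨hr0, ?_⟩
    nlinarith))
  simp [sub_dotProduct] at h1
  rw [soc, Set.mem_ofPred_eq, sum_spatial_sq, ← hr]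
  rcases hr0.eq_or_lt with h | h
  · rwa [← h]
  · nlinarith

theorem abs_dotProduct_mulVec_le (B : Matrix (Fin n) (Fin n) ℝ) (u : Fin n → ℝ) :
    |u ⬝ᵥ B *ᵥ u| ≤ (∑ i, ∑ j, |B i j|) * (u ⬝ᵥ u) := by
  have hu : ∀ i, u i ^ 2 ≤ u ⬝ᵥ u := fun i => by
    rw [sq]
    exact Finset.single_le_sum (f := fun i => u i * u i) (fun i _ => mul_self_nonneg (u i))
      (Finset.mem_univ i)
  calc |u ⬝ᵥ B *ᵥ u| = |∑ i, ∑ j, B i j * (u i * u j)| := by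
        simp only [dotProduct, mulVec, Finset.mul_sum]
        congr 1
        refine Finset.sum_congr rfl fun i _ => Finset.sum_congr rfl fun j _ => ?_
        ring
    _ ≤ ∑ i, ∑ j, |B i j * (u i * u j)| :=
        (Finset.abs_sum_le_sum_abs _ _).trans
          (Finset.sum_le_sum fun i _ => Finset.abs_sum_le_sum_abs _ _)
    _ ≤ ∑ i, ∑ j, |B i j| * (u ⬝ᵥ u) := by
        gcongr with i _ j _
        rw [abs_mul]
        gcongr
        rw [abs_le]
        constructor <;> nlinarith [hu i, hu j, sq_nonneg (u i + u j), sq_nonneg (u i - u j)]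
    _ = (∑ i, ∑ j, |B i j|) * (u ⬝ᵥ u) := by simp only [Finset.sum_mul]

/-- A quadratic form that is nonnegative on the boundary of the second order cone becomes
nonnegative on the whole cone after adding a large multiple of the Lorentz form. -/
theorem nonneg_add_mul_of_nonneg_on_socBd [NeZero n] (B : Matrix (Fin n) (Fin n) ℝ)
    (hB : ∀ x, x ⬝ᵥ (Jmat n *ᵥ x) = 0 → x ∈ soc n → 0 ≤ x ⬝ᵥ B *ᵥ x)
    {x : Fin n → ℝ} (hx : x ∈ soc n) :
    0 ≤ x ⬝ᵥ B *ᵥ x + (∑ i, ∑ j, |B i j|) * (x ⬝ᵥ (Jmat n *ᵥ x)) := by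
  set K := ∑ i, ∑ j, |B i j|
  set e : Fin n → ℝ := Pi.single 0 1
  set t := x 0
  obtain ⟨u, hu⟩ : ∃ u, u = x - t • e := ⟨_, rfl⟩
  have hu0 : u 0 = 0 := by simp [hu, e, t]
  have hxu : x = t • e + u := by simp [hu]
  have hee : e ⬝ᵥ e = 1 := by simp [e]
  have heu : e ⬝ᵥ u = 0 := by simp [e, hu0]
  have hue : u ⬝ᵥ e = 0 := by simp [e, hu0]
  have he0 : e 0 = 1 := by simp [e]
  have hq : ∀ s : ℝ, (s • e + u) ⬝ᵥ B *ᵥ (s • e + u) =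
      s ^ 2 * (e ⬝ᵥ B *ᵥ e) + s * (e ⬝ᵥ B *ᵥ u + u ⬝ᵥ B *ᵥ e) + u ⬝ᵥ B *ᵥ u := fun s => by
    simp only [mulVec_add, mulVec_smul, add_dotProduct, dotProduct_add, smul_dotProduct,
      dotProduct_smul, smul_eq_mul]
    ring
  have hd : ∀ s : ℝ, (s • e + u) ⬝ᵥ (s • e + u) = s ^ 2 + u ⬝ᵥ u := fun s => by
    simp only [add_dotProduct, dotProduct_add, smul_dotProduct,
      dotProduct_smul, smul_eq_mul, hee, heu, hue]
    ring
  have hc := abs_le.1 (abs_dotProduct_mulVec_le B u)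
  have ha := abs_le.1 (abs_dotProduct_mulVec_le B e)
  obtain ⟨ht, hx2⟩ := mem_soc_iff.1 hx
  rw [dotProduct_Jmat_mulVec]
  have hxx : x ⬝ᵥ x = t ^ 2 + u ⬝ᵥ u := by rw [← hd, ← hxu]
  have hxB := hq t
  rw [← hxu] at hxB
  rw [hxx] at hx2 ⊢
  rw [hxB]
  change 0 ≤ t at ht
  change _ ≤ 2 * t ^ 2 at hx2
  change 0 ≤ _ + K * (2 * (t * t) - _)
  set r := Real.sqrt (u ⬝ᵥ u) with hr
  have hr0 : 0 ≤ r := Real.sqrt_nonneg _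
  have hr2 : r ^ 2 = u ⬝ᵥ u := Real.sq_sqrt (dotProduct_self_nonneg_real _)
  rcases hr0.eq_or_lt with h | h
  · have : u = 0 := dotProduct_self_eq_zero.1 (by rw [← hr2, ← h]; simp)
    subst this
    rw [hee] at ha
    simp
    nlinarith [sq_nonneg t, ha.1]
  · have h1 := hB (r • e + u)
      (by rw [dotProduct_Jmat_mulVec, hd]; simp [hu0, he0]; linarith)
      (mem_soc_iff.2 (by rw [hd]; simp [hu0, he0]; exact ⟨hr0, by linarith⟩))
    have hneg : -((-r) • e + u) = r • e - u := by
      rw [neg_add, neg_smul, neg_neg, sub_eq_add_neg]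
    have h2 := hB (-((-r) • e + u))
      (by rw [dotProduct_Jmat_mulVec, neg_dotProduct_neg, hd]; simp [hu0, he0]; linarith)
      (mem_soc_iff.2 (by rw [neg_dotProduct_neg, hd]; simp [hu0, he0]; exact ⟨hr0, by linarith⟩))
    rw [mulVec_neg, neg_dotProduct_neg, hq] at h2
    rw [hq] at h1
    rw [← hr2] at hx2 hc ⊢
    generalize e ⬝ᵥ B *ᵥ e = a at *
    generalize e ⬝ᵥ B *ᵥ u + u ⬝ᵥ B *ᵥ e = b at *
    generalize u ⬝ᵥ B *ᵥ u = c at *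
    have hrt : r ≤ t := abs_le_of_sq_le_sq' (by linarith) ht |>.2
    refine nonneg_of_mul_nonneg_right (a := r ^ 2) ?_ (by positivity)
    have e1 : r ^ 2 * (t ^ 2 * a + t * b + c + K * (2 * (t * t) - (t ^ 2 + r ^ 2))) =
      (K * r ^ 2 - c) * (t ^ 2 - r ^ 2) + t * (t - r) * (r ^ 2 * a + c)
        + t * r * (r ^ 2 * a + r * b + c) := by ring
    rw [e1]
    have h3 : 0 ≤ r ^ 2 * a + c := by nlinarith
    have h4 : 0 ≤ t - r := by linarith
    have h5 : 0 ≤ t ^ 2 - r ^ 2 := by linarith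
    have h6 : 0 ≤ K * r ^ 2 - c := by linarith [hc.2]
    positivity

end SecondOrderCone

theorem stmt1 (n : ℕ) [NeZero n] (hn : 1 < n) (A : Matrix (Fin n) (Fin n) ℝ) :
    IsZTransf (soc n) A ↔
      ∃ (γ : ℝ) (P Q : Matrix (Fin n) (Fin n) ℝ),
        Pᵀ = P ∧ (∀ x ∈ soc n, 0 ≤ x ⬝ᵥ P.mulVec x) ∧ Qᵀ = -Q ∧
        A = γ • (1 : Matrix (Fin n) (Fin n) ℝ) - Jmat n * (P + Q) := by
  constructor
  · intro hA
    obtain ⟨B, hBdef⟩ : ∃ B, B = -(Jmat n * A) := ⟨_, rfl⟩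
    have hB : ∀ x, x ⬝ᵥ (Jmat n *ᵥ x) = 0 → x ∈ soc n → 0 ≤ x ⬝ᵥ B *ᵥ x := by
      intro x hx0 hx
      have h := hA x hx _ (soc_subset_dualCone (Jmat_mulVec_mem_soc hx)) hx0
      rw [dotProduct_mulVec, ← mulVec_transpose, Jmat_transpose, mulVec_mulVec,
        dotProduct_comm] at h
      rw [hBdef, neg_mulVec, dotProduct_neg]
      linarith
    refine ⟨∑ i, ∑ j, |B i j|, (1 / 2 : ℝ) • (B + Bᵀ) + (∑ i, ∑ j, |B i j|) • Jmat n,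
      (1 / 2 : ℝ) • (B - Bᵀ), ?_, ?_, ?_, ?_⟩
    · simp [Jmat_transpose, add_comm]
    · intro x hx
      have h := nonneg_add_mul_of_nonneg_on_socBd B hB hx
      have hT : x ⬝ᵥ Bᵀ *ᵥ x = x ⬝ᵥ B *ᵥ x := by
        rw [mulVec_transpose, dotProduct_comm, ← dotProduct_mulVec]
      simp only [add_mulVec, smul_mulVec, dotProduct_add, dotProduct_smul, hT, smul_eq_mul]
      linarith
    · rw [transpose_smul, transpose_sub, transpose_transpose, ← smul_neg, neg_sub]
    · have hPQ : (1 / 2 : ℝ) • (B + Bᵀ) + (∑ i, ∑ j, |B i j|) • Jmat n + (1 / 2 : ℝ) • (B - Bᵀ)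
          = B + (∑ i, ∑ j, |B i j|) • Jmat n := by
        module
      have hJB : Jmat n * B = -A := by
        rw [hBdef, mul_neg, ← mul_assoc, Jmat_mul_self, one_mul]
      rw [hPQ, mul_add, Matrix.mul_smul, Jmat_mul_self, hJB]
      abel
  · rintro ⟨γ, P, Q, -, hP, hQ, hA⟩ x hx y hy hxy
    have hy := dualCone_subset_soc hy
    have h := dotProduct_self_smul_sub_smul_Jmat_le hy hx
    rw [dotProduct_comm y x, hxy, mul_zero] at h
    have hyx : x 0 • y = y 0 • (Jmat n *ᵥ x) :=
      sub_eq_zero.1 (dotProduct_self_eq_zero.1 (le_antisymm h (dotProduct_self_nonneg_real _)))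
    rcases (mem_soc_iff.1 hx).1.eq_or_lt with hx0 | hx0
    · simp [eq_zero_of_mem_soc hx hx0.symm]
    refine nonpos_of_mul_nonpos_right (a := x 0) ?_ hx0
    have hQ0 : x ⬝ᵥ Q *ᵥ x = 0 := by
      have : x ⬝ᵥ Qᵀ *ᵥ x = x ⬝ᵥ Q *ᵥ x := by
        rw [mulVec_transpose, dotProduct_comm, ← dotProduct_mulVec]
      rw [hQ, neg_mulVec, dotProduct_neg] at this
      linarith
    have hJJ : (Jmat n * (P + Q)) *ᵥ x ⬝ᵥ Jmat n *ᵥ x = x ⬝ᵥ P *ᵥ x := by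
      rw [dotProduct_mulVec, ← mulVec_transpose, Jmat_transpose, mulVec_mulVec, ← mul_assoc,
        Jmat_mul_self, one_mul, dotProduct_comm, add_mulVec, dotProduct_add, hQ0, add_zero]
    have hxJ : y 0 * (x ⬝ᵥ Jmat n *ᵥ x) = 0 := by
      rw [← smul_eq_mul, ← dotProduct_smul, ← hyx, dotProduct_smul, hxy, smul_zero]
    calc x 0 * (A *ᵥ x ⬝ᵥ y) = y 0 * (A *ᵥ x ⬝ᵥ Jmat n *ᵥ x) := by
          rw [← smul_eq_mul, ← dotProduct_smul, hyx, dotProduct_smul, smul_eq_mul]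
      _ = γ * (y 0 * (x ⬝ᵥ Jmat n *ᵥ x)) - y 0 * (x ⬝ᵥ P *ᵥ x) := by
          rw [hA, sub_mulVec, sub_dotProduct, hJJ, smul_mulVec, one_mulVec, smul_dotProduct,
            smul_eq_mul]
          ring
      _ ≤ 0 := by
          rw [hxJ]
          linarith [mul_nonneg (mem_soc_iff.1 hy).1 (hP x hx)]
end
end

section
/- Let n > 1, let L be the second order cone in ℝ^n with boundary ∂L, and let J = diag(1,−1,…,−1). Then {X ∈ ℝ^{n×n} : tr(JX) = 0 and X is symmetric positive semidefinite} = {X ∈ ℝ^{n×n} : tr(JX) = 0 and X ∈ K_{∂L}}, where K_{∂L} is the set of finite sums Σᵢ uᵢuᵢᵀ with all uᵢ ∈ ∂L. -/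
open Matrix

noncomputable section

/-- Rotating a pair of vectors does not change the sum of their rank-one matrices. -/
lemma vecMulVec_rotate_add {ι : Type*} (v w : ι → ℝ) (θ : ℝ) :
    vecMulVec (Real.cos θ • v + Real.sin θ • w) (Real.cos θ • v + Real.sin θ • w) +
      vecMulVec (-Real.sin θ • v + Real.cos θ • w) (-Real.sin θ • v + Real.cos θ • w) =
      vecMulVec v v + vecMulVec w w := by
  ext i j
  simp only [Matrix.add_apply, vecMulVec_apply, Pi.add_apply, Pi.smul_apply, smul_eq_mul]
  linear_combination (v i * v j + w i * w j) * Real.sin_sq_add_cos_sq θ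

/-- If a linear functional is positive on `vvᵀ` and negative on `wwᵀ`, then it vanishes on `zzᵀ`
for some rotation `(z, z')` of the pair `(v, w)`. -/
lemma exists_vecMulVec_rotation {ι : Type*} [Fintype ι] (φ : Matrix ι ι ℝ →ₗ[ℝ] ℝ) {v w : ι → ℝ}
    (hv : 0 < φ (vecMulVec v v)) (hw : φ (vecMulVec w w) < 0) :
    ∃ z z' : ι → ℝ, φ (vecMulVec z z) = 0 ∧
      vecMulVec z z + vecMulVec z' z' = vecMulVec v v + vecMulVec w w := by
  have hφ : Continuous φ := φ.continuous_of_finiteDimensional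
  let z : ℝ → ι → ℝ := fun θ => Real.cos θ • v + Real.sin θ • w
  have hc : Continuous fun θ => φ (vecMulVec (z θ) (z θ)) := by
    have hz : Continuous z := by fun_prop
    exact hφ.comp (hz.matrix_vecMulVec hz)
  have h0 : 0 ∈ Set.Icc (φ (vecMulVec (z (Real.pi / 2)) (z (Real.pi / 2))))
      (φ (vecMulVec (z 0) (z 0))) := by
    simpa [z] using ⟨hw.le, hv.le⟩
  obtain ⟨θ, -, hθ⟩ := intermediate_value_Icc' (by positivity) hc.continuousOn h0
  exact ⟨z θ, _, hθ, vecMulVec_rotate_add v w θ⟩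

/-- A sum of rank-one matrices `vᵢvᵢᵀ` annihilated by a linear functional can be rewritten so that
each summand is annihilated by it. -/
lemma exists_sum_vecMulVec_eq {ι κ : Type*} [Fintype ι] [DecidableEq κ]
    (φ : Matrix ι ι ℝ →ₗ[ℝ] ℝ) (s : Finset κ) (v : κ → ι → ℝ)
    (h : φ (∑ i ∈ s, vecMulVec (v i) (v i)) = 0) :
    ∃ w : κ → ι → ℝ, (∀ i ∈ s, φ (vecMulVec (w i) (w i)) = 0) ∧
      ∑ i ∈ s, vecMulVec (w i) (w i) = ∑ i ∈ s, vecMulVec (v i) (v i) := by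
  induction s using Finset.strongInduction generalizing v with
  | H s ih =>
    by_cases hs : ∀ i ∈ s, φ (vecMulVec (v i) (v i)) = 0
    · exact ⟨v, hs, rfl⟩
    push Not at hs
    obtain ⟨k, hk, hk0⟩ := hs
    have h' : ∑ i ∈ s, φ (vecMulVec (v i) (v i)) = 0 := by rwa [map_sum] at h
    obtain ⟨i, hi, hpos⟩ := Finset.exists_pos_of_sum_zero_of_exists_nonzero _ h' ⟨k, hk, hk0⟩
    obtain ⟨j, hj, hneg⟩ : ∃ j ∈ s, φ (vecMulVec (v j) (v j)) < 0 := by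
      by_contra! hnn
      exact hpos.ne' ((Finset.sum_eq_zero_iff_of_nonneg hnn).1 h' i hi)
    have hji : j ≠ i := by rintro rfl; exact lt_asymm hpos hneg
    obtain ⟨z, z', hz, hzz⟩ := exists_vecMulVec_rotation φ hpos hneg
    have hj' : j ∈ s.erase i := Finset.mem_erase.2 ⟨hji, hj⟩
    have key : vecMulVec z z + ∑ l ∈ s.erase i,
        vecMulVec (Function.update v j z' l) (Function.update v j z' l) =
        ∑ l ∈ s, vecMulVec (v l) (v l) := by
      have hrest : ∀ l ∈ (s.erase i).erase j,
          vecMulVec (Function.update v j z' l) (Function.update v j z' l) =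
            vecMulVec (v l) (v l) := fun l hl => by
        rw [Function.update_of_ne (Finset.ne_of_mem_erase hl)]
      rw [← Finset.add_sum_erase s _ hi, ← Finset.add_sum_erase _ _ hj',
        ← Finset.add_sum_erase (s.erase i) (fun l => vecMulVec (v l) (v l)) hj',
        Finset.sum_congr rfl hrest, Function.update_self, ← add_assoc, ← add_assoc, hzz]
    obtain ⟨w, hw, hsum⟩ := ih _ (Finset.erase_ssubset hi) (Function.update v j z') (by
      rw [← key, map_add, hz, zero_add] at h
      exact h)
    refine ⟨Function.update w i z, fun l hl => ?_, ?_⟩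
    · rcases eq_or_ne l i with rfl | hli
      · simpa using hz
      · simpa [hli] using hw l (Finset.mem_erase.2 ⟨hli, hl⟩)
    · have hrest : ∀ l ∈ s.erase i,
          vecMulVec (Function.update w i z l) (Function.update w i z l) =
            vecMulVec (w l) (w l) := fun l hl => by
        rw [Function.update_of_ne (Finset.ne_of_mem_erase hl)]
      rw [← key, ← hsum, ← Finset.add_sum_erase s _ hi, Finset.sum_congr rfl hrest,
        Function.update_self]

lemma trace_Jmat_mul_vecMulVec (n : ℕ) [NeZero n] (v : Fin n → ℝ) :
    (Jmat n * vecMulVec v v).trace = v 0 ^ 2 - ∑ i, if i = 0 then 0 else v i ^ 2 := by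
  have h0 : v 0 ^ 2 = ∑ i, if i = 0 then v i ^ 2 else 0 := by simp
  rw [h0, ← Finset.sum_sub_distrib]
  refine Finset.sum_congr rfl fun i _ => ?_
  simp only [Jmat, Matrix.diag_apply, Matrix.diagonal_mul, vecMulVec_apply]
  split_ifs <;> ring

/-- A null vector of `J` lies, up to sign, on the boundary of the second order cone. -/
lemma exists_mem_socBd_vecMulVec_eq (n : ℕ) [NeZero n] (v : Fin n → ℝ)
    (h : (Jmat n * vecMulVec v v).trace = 0) :
    ∃ u ∈ socBd n, vecMulVec u u = vecMulVec v v := by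
  rw [trace_Jmat_mul_vecMulVec, sub_eq_zero] at h
  rcases le_total 0 (v 0) with h0 | h0
  · exact ⟨v, by simp [socBd, ← h, Real.sqrt_sq h0], rfl⟩
  · exact ⟨-v, by simp [socBd, ← h, Real.sqrt_sq_eq_abs, abs_of_nonpos h0],
      by ext; simp [vecMulVec_apply]⟩

lemma posSemidef_of_mem_cpCone {n : ℕ} {C : Set (Fin n → ℝ)} {X : Matrix (Fin n) (Fin n) ℝ}
    (hX : X ∈ cpCone C) : X.PosSemidef := by
  obtain ⟨m, u, -, rfl⟩ := hX
  exact Matrix.posSemidef_sum _ fun i _ => by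
    simpa using Matrix.posSemidef_vecMulVec_self_star (u i)

theorem stmt6 (n : ℕ) [NeZero n] (hn : 1 < n) :
    {X : Matrix (Fin n) (Fin n) ℝ | (Jmat n * X).trace = 0 ∧ X.PosSemidef} =
      {X : Matrix (Fin n) (Fin n) ℝ | (Jmat n * X).trace = 0 ∧ X ∈ cpCone (socBd n)} := by
  ext X
  refine and_congr_right fun hX => ⟨fun hpsd => ?_, posSemidef_of_mem_cpCone⟩
  obtain ⟨m, v, hv⟩ := Matrix.posSemidef_iff_eq_sum_vecMulVec.mp hpsd
  simp only [star_trivial] at hv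
  subst hv
  let φ : Matrix (Fin n) (Fin n) ℝ →ₗ[ℝ] ℝ :=
    Matrix.traceLinearMap (Fin n) ℝ ℝ ∘ₗ LinearMap.mulLeft ℝ (Jmat n)
  obtain ⟨w, hw, hsum⟩ := exists_sum_vecMulVec_eq φ Finset.univ v hX
  choose u hu huw using fun i => exists_mem_socBd_vecMulVec_eq n (w i) (hw i (Finset.mem_univ i))
  exact ⟨m, u, hu, by simp only [huw, hsum]⟩
end
end

section
/- Let n > 1 and let ∂L = {(t,u) ∈ ℝ × ℝ^{n−1} : t = ‖u‖} be the boundary of the second order cone in ℝ^n. A symmetric matrix X ∈ ℝ^{n×n} is copositive on ∂L (i.e., xᵀXx ≥ 0 for all x ∈ ∂L) if and only if there exists μ ∈ ℝ such that X − μJ is positive semidefinite, where J = diag(1,−1,…,−1). Equivalently, E_{∂L} = S^n_+ + ℝ·J. -/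
open Matrix

noncomputable section

/-- If `B x x > 0 > B y y` and `A` is nonnegative on the isotropic vectors of `B`, then
`A y y / B y y ≤ A x x / B x x`. -/
theorem bilin_cross_nonneg {V : Type*} [AddCommGroup V] [Module ℝ V]
    (A B : LinearMap.BilinForm ℝ V) (h : ∀ z, B z z = 0 → 0 ≤ A z z) {x y : V}
    (hx : 0 < B x x) (hy : B y y < 0) : 0 ≤ A y y * B x x - A x x * B y y := by
  set p := B x x with hp
  set s := B y y with hs
  set c := B x y + B y x with hc
  have expand (C : LinearMap.BilinForm ℝ V) (a b : ℝ) :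
      C (a • x + b • y) (a • x + b • y)
        = a ^ 2 * C x x + a * b * (C x y + C y x) + b ^ 2 * C y y := by
    simp only [map_add, map_smul, LinearMap.add_apply, LinearMap.smul_apply, smul_eq_mul]
    ring
  obtain ⟨a, ha⟩ : ∃ a : ℝ, p * (a * a) + c * a + s = 0 := by
    refine exists_quadratic_eq_zero hx.ne' ⟨√(discrim p c s), ?_⟩
    rw [Real.mul_self_sqrt]
    rw [discrim]
    nlinarith [sq_nonneg c, mul_pos_of_neg_of_neg hy (neg_lt_zero.mpr hx)]
  have h₁ := h (a • x + (1 : ℝ) • y) (by rw [expand]; linear_combination ha)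
  have h₂ := h (s • x + (p * a) • y) (by rw [expand]; linear_combination s * p * ha)
  rw [expand] at h₁ h₂
  have key : 0 ≤ (A y y * p - A x x * s) * (p * a ^ 2 - s) := by
    nlinarith [mul_nonneg (mul_pos hx (neg_pos.mpr hy)).le h₁]
  exact nonneg_of_mul_nonneg_left key (by nlinarith [mul_nonneg hx.le (sq_nonneg a)])

/-- The homogeneous S-lemma with an equality constraint. -/
theorem exists_forall_mul_bilin_le {V : Type*} [AddCommGroup V] [Module ℝ V]
    (A B : LinearMap.BilinForm ℝ V) (h : ∀ z, B z z = 0 → 0 ≤ A z z)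
    (hpos : ∃ x, 0 < B x x) (hneg : ∃ y, B y y < 0) :
    ∃ μ : ℝ, ∀ x, μ * B x x ≤ A x x := by
  obtain ⟨x₀, hx₀⟩ := hpos
  obtain ⟨y₀, hy₀⟩ := hneg
  let S : Set ℝ := {r | ∃ y, B y y < 0 ∧ r = A y y / B y y}
  have upper {x : V} (hx : 0 < B x x) : A x x / B x x ∈ upperBounds S := by
    rintro _ ⟨y, hy, rfl⟩
    rw [div_le_iff_of_neg hy, div_mul_eq_mul_div, div_le_iff₀ hx]
    linarith [bilin_cross_nonneg A B h hx hy]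
  refine ⟨sSup S, fun x => ?_⟩
  rcases lt_trichotomy (B x x) 0 with hx | hx | hx
  · exact (div_le_iff_of_neg hx).mp (le_csSup ⟨_, upper hx₀⟩ ⟨x, hx, rfl⟩)
  · simpa [hx] using h x hx
  · exact (le_div_iff₀ hx).mp (csSup_le ⟨_, y₀, hy₀, rfl⟩ (upper hx))

theorem dotProduct_Jmat_mulVec_s8 (n : ℕ) [NeZero n] (x : Fin n → ℝ) :
    x ⬝ᵥ (Jmat n).mulVec x = x 0 ^ 2 - ∑ i, if i = 0 then 0 else x i ^ 2 := by
  have h0 : x 0 ^ 2 = ∑ i, if i = 0 then x i ^ 2 else 0 := by simp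
  rw [h0, ← Finset.sum_sub_distrib]
  refine Finset.sum_congr rfl fun i _ => ?_
  rw [Jmat, mulVec_diagonal]
  split_ifs <;> ring

theorem mem_socBd_iff (n : ℕ) [NeZero n] (x : Fin n → ℝ) :
    x ∈ socBd n ↔ 0 ≤ x 0 ∧ x ⬝ᵥ (Jmat n).mulVec x = 0 := by
  have hs : 0 ≤ ∑ i, if i = 0 then 0 else x i ^ 2 :=
    Finset.sum_nonneg fun i _ => by split_ifs <;> positivity
  rw [dotProduct_Jmat_mulVec_s8, sub_eq_zero, socBd, Set.mem_ofPred_eq]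
  constructor
  · intro h
    exact ⟨h ▸ Real.sqrt_nonneg _, by rw [← h, Real.sq_sqrt hs]⟩
  · rintro ⟨h0, h⟩
    rw [← h, Real.sqrt_sq h0]

theorem stmt8 (n : ℕ) [NeZero n] (hn : 1 < n) (X : Matrix (Fin n) (Fin n) ℝ)
    (hX : Xᵀ = X) :
    (∀ x ∈ socBd n, 0 ≤ x ⬝ᵥ X.mulVec x) ↔
      ∃ μ : ℝ, (X - μ • Jmat n).PosSemidef := by
  have sub_apply (μ : ℝ) (x : Fin n → ℝ) : x ⬝ᵥ (X - μ • Jmat n).mulVec x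
      = x ⬝ᵥ X.mulVec x - μ * (x ⬝ᵥ (Jmat n).mulVec x) := by
    rw [sub_mulVec, dotProduct_sub, smul_mulVec, dotProduct_smul, smul_eq_mul]
  have hne : (⟨1, hn⟩ : Fin n) ≠ 0 := by
    rw [Ne, Fin.ext_iff, Fin.val_zero]
    exact one_ne_zero
  constructor
  · intro h
    obtain ⟨μ, hμ⟩ := exists_forall_mul_bilin_le (Matrix.toBilin' X) (Matrix.toBilin' (Jmat n))
      (fun z hz => by
        rw [Matrix.toBilin'_apply'] at hz ⊢
        rcases le_total 0 (z 0) with h0 | h0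
        · exact h z ((mem_socBd_iff n z).mpr ⟨h0, hz⟩)
        · simpa [mulVec_neg] using h (-z) ((mem_socBd_iff n (-z)).mpr
            ⟨by simpa using h0, by simpa [mulVec_neg] using hz⟩))
      ⟨Pi.single 0 1, by simp [Matrix.toBilin'_single, Jmat]⟩
      ⟨Pi.single ⟨1, hn⟩ 1, by simp [Matrix.toBilin'_single, Jmat, hne]⟩
    refine ⟨μ, PosSemidef.of_dotProduct_mulVec_nonneg ?_ fun x => ?_⟩
    · rw [IsHermitian, conjTranspose_eq_transpose_of_trivial, transpose_sub, transpose_smul, hX,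
        Jmat, diagonal_transpose]
    · rw [star_trivial, sub_apply, sub_nonneg]
      simpa only [Matrix.toBilin'_apply'] using hμ x
  · rintro ⟨μ, hμ⟩ x hx
    have h := hμ.dotProduct_mulVec_nonneg x
    rwa [star_trivial, sub_apply, ((mem_socBd_iff n x).mp hx).2, mul_zero, sub_zero] at h
end
end
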